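/- Let A = (Q, Σ, δ) be a partial DFA and let S ⊆ Q be a non-empty subset. Then there exists a word w ∈ Σ* with 2·|w| ≤ (κ(S) − 1)·(2κ(Q) − κ(S)) such that δ(S,w) is non-empty and is contained in a single inseparability class of ≡. -/

import Mathlib

open scoped Classical

section Defs

variable {Q A : Type*}

/-- Action of a word in a partial DFA with transition function `δ`
(`none` means the undefined value ⊥). -/
def stepWord (δ : Q → A → Option Q) : Q → List A → Option Q
  | q, [] => some q
  | q, a :: w => (δ q a).bind (fun p => stepWord δ p w)

/-- The image `δ(S, w)` of a set of states under the action of a word. -/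
def img (δ : Q → A → Option Q) (S : Set Q) (w : List A) : Set Q :=
  {p | ∃ q ∈ S, stepWord δ q w = some p}

/-- The inseparability equivalence `p ≡ q`. -/
def Insep (δ : Q → A → Option Q) (p q : Q) : Prop :=
  ∀ u : List A, (stepWord δ p u).isSome ↔ (stepWord δ q u).isSome

/-- `κ(S)`: the number of inseparability classes intersecting `S`. -/
noncomputable def kappa (δ : Q → A → Option Q) (S : Set Q) : ℕ :=
  {C : Set Q | ∃ p ∈ S, C = {q | Insep δ p q}}.ncard

def StronglyConnected (δ : Q → A → Option Q) : Prop :=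
  ∀ p q : Q, ∃ w : List A, stepWord δ p w = some q

/-- The transition function of the fixing automaton `A^F`. -/
def fixDelta (δ : Q → A → Option Q) (q : Q) (a : A) : Q := (δ q a).getD q

/-- Action of a word in a complete DFA. -/
def stepWordC (δc : Q → A → Q) (q : Q) (w : List A) : Q := w.foldl δc q

/-- The image of a set of states under the action of a word in a complete DFA. -/
def imgC (δc : Q → A → Q) (S : Set Q) (w : List A) : Set Q :=
  (fun q => stepWordC δc q w) '' S

end Defs

section Helpers

variable {Q A : Type*} {δ : Q → A → Option Q}

/-- The states `p` and `q` are not separated by any word of length at most `m`. -/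
def InsepUpTo (δ : Q → A → Option Q) (m : ℕ) (p q : Q) : Prop :=
  ∀ u : List A, u.length ≤ m → ((stepWord δ p u).isSome ↔ (stepWord δ q u).isSome)

lemma stepWord_append (p : Q) (u v : List A) :
    stepWord δ p (u ++ v) = (stepWord δ p u).bind (fun q => stepWord δ q v) := by
  induction u generalizing p with
  | nil => simp [stepWord]
  | cons a u ih => simp [stepWord, ih, Option.bind_assoc]

lemma img_append (S : Set Q) (u v : List A) : img δ S (u ++ v) = img δ (img δ S u) v := by
  ext p
  simp only [img, Set.mem_ofPred_eq, stepWord_append, Option.bind_eq_some_iff]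
  grind

lemma setOf_insep_eq_iff {p q : Q} :
    {r | Insep δ p r} = {r | Insep δ q r} ↔ Insep δ p q := by
  simp only [Set.ext_iff, Set.mem_ofPred_eq]
  exact ⟨fun h => (h q).2 fun _ => Iff.rfl, fun h r =>
    ⟨fun hr u => (h u).symm.trans (hr u), fun hr u => (h u).trans (hr u)⟩⟩

lemma setOf_insepUpTo_eq_iff {m : ℕ} {p q : Q} :
    {r | InsepUpTo δ m p r} = {r | InsepUpTo δ m q r} ↔ InsepUpTo δ m p q := by
  simp only [Set.ext_iff, Set.mem_ofPred_eq]
  exact ⟨fun h => (h q).2 fun _ _ => Iff.rfl, fun h r =>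
    ⟨fun hr u hu => (h u hu).symm.trans (hr u hu), fun hr u hu => (h u hu).trans (hr u hu)⟩⟩

lemma kappa_eq_ncard_image (S : Set Q) :
    kappa δ S = ((fun p => {q | Insep δ p q}) '' S).ncard := by
  unfold kappa
  congr 1
  ext C
  simp [eq_comm]

lemma Insep.of_stepWord {p q p' q' : Q} {u : List A} (h : Insep δ p q)
    (hp : stepWord δ p u = some p') (hq : stepWord δ q u = some q') : Insep δ p' q' := by
  intro v
  simpa [stepWord_append, hp, hq] using h (u ++ v)

/-- If `g` factors through `f` and is constant on `S`, then passing from `f` to `g` loses at least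
`|f(S)| - 1` values. -/
lemma ncard_image_add_ncard_range_le {X Y : Type*} [Finite Q] (f : Q → X) (g : Q → Y)
    (hfg : ∀ p q, f p = f q → g p = g q) {S : Set Q} (hS : S.Nonempty)
    (hg : ∀ p ∈ S, ∀ q ∈ S, g p = g q) :
    (f '' S).ncard + (Set.range g).ncard ≤ (Set.range f).ncard + 1 := by
  obtain ⟨s, hs⟩ := hS
  have : Nonempty Q := ⟨s⟩
  have hinv : ∀ y ∈ Set.range g, g (Function.invFun g y) = y := fun y hy =>
    Function.invFun_eq hy
  have hle : (Set.range g \ {g s}).ncard ≤ (Set.range f \ f '' S).ncard := by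
    refine Set.ncard_le_ncard_of_injOn (fun y => f (Function.invFun g y)) ?_ ?_
      (Set.toFinite _)
    · rintro y ⟨hy, hne⟩
      refine ⟨⟨_, rfl⟩, ?_⟩
      rintro ⟨t, ht, hft⟩
      apply hne
      rw [Set.mem_singleton_iff, ← hinv y hy, ← hfg _ _ hft]
      exact hg t ht s hs
    · intro y hy z hz hyz
      rw [← hinv y hy.1, ← hinv z hz.1]
      exact hfg _ _ hyz
  have h1 := Set.ncard_sdiff_singleton_add_one (Set.mem_range_self (f := g) s) (Set.toFinite _)
  have h2 := Set.ncard_sdiff_add_ncard_of_subset (Set.image_subset_range f S) (Set.toFinite _)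
  omega

/-- Once the refinement by word length is stationary, it has reached inseparability. -/
lemma insep_of_insepUpTo_stationary {m : ℕ}
    (h : ∀ p q, InsepUpTo δ m p q → InsepUpTo δ (m + 1) p q) {p q : Q}
    (hpq : InsepUpTo δ m p q) : Insep δ p q := by
  intro u
  induction u generalizing p q with
  | nil => simp [stepWord]
  | cons a u ih =>
    have h' := h p q hpq
    have h1 := h' [a] (by simp)
    rcases hp : δ p a with _ | p' <;> rcases hq : δ q a with _ | q' <;>
      simp [stepWord, hp, hq] at h1 ⊢
    have := ih (p := p') (q := q') fun v hv => by
      simpa [stepWord, hp, hq] using h' (a :: v) (by simpa using hv)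
    simpa using this

lemma InsepUpTo.mono {m n : ℕ} (hmn : m ≤ n) {p q : Q} (h : InsepUpTo δ n p q) :
    InsepUpTo δ m p q :=
  fun u hu => h u (hu.trans hmn)

/-- As long as words of length `m` do not realise inseparability, they yield more than `m`
classes. -/
lemma lt_ncard_range_insepUpTo [Finite Q] {m : ℕ}
    (h : ∃ p q, InsepUpTo δ m p q ∧ ¬ Insep δ p q) :
    m < (Set.range fun p => {q | InsepUpTo δ m p q}).ncard := by
  induction m with
  | zero =>
    obtain ⟨p, -⟩ := h
    exact (Set.ncard_pos (Set.toFinite _)).2 ⟨_, p, rfl⟩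
  | succ m ih =>
    obtain ⟨p, q, hpq, hns⟩ := h
    have hm := ih ⟨p, q, hpq.mono m.le_succ, hns⟩
    obtain ⟨x, y, hxy, hxy'⟩ : ∃ x y, InsepUpTo δ m x y ∧ ¬ InsepUpTo δ (m + 1) x y := by
      by_contra! hst
      exact hns (insep_of_insepUpTo_stationary hst (hpq.mono m.le_succ))
    have hcount := ncard_image_add_ncard_range_le
      (fun p => {q | InsepUpTo δ (m + 1) p q}) (fun p => {q | InsepUpTo δ m p q})
      (fun p q h => setOf_insepUpTo_eq_iff.2 ((setOf_insepUpTo_eq_iff.1 h).mono m.le_succ))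
      (S := {x, y}) (Set.insert_nonempty _ _) (by
        have := setOf_insepUpTo_eq_iff.2 hxy
        rintro p (rfl | rfl) q (rfl | rfl) <;> simp [this])
    rw [Set.image_pair, Set.ncard_pair (fun h => hxy' (setOf_insepUpTo_eq_iff.1 h))] at hcount
    omega

lemma kappa_mono [Finite Q] {S T : Set Q} (h : S ⊆ T) : kappa δ S ≤ kappa δ T := by
  simp only [kappa_eq_ncard_image]
  exact Set.ncard_le_ncard (Set.image_mono h) (Set.toFinite _)

/-- If `S` meets several classes, some two of its states are separated by a word of length at most
`κ(Q) - κ(S) + 1`. -/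
lemma exists_short_separating_word [Finite Q] {S : Set Q}
    (h : ∃ p ∈ S, ∃ q ∈ S, ¬ Insep δ p q) :
    ∃ u : List A, u.length + kappa δ S ≤ kappa δ Set.univ + 1 ∧
      ∃ p ∈ S, ∃ q ∈ S, (stepWord δ p u).isSome ∧ stepWord δ q u = none := by
  obtain ⟨p, hp, q, hq, hpq⟩ := h
  have hle := kappa_mono (δ := δ) (Set.subset_univ S)
  obtain ⟨m, hm⟩ : ∃ m, m + kappa δ S = kappa δ Set.univ + 1 :=
    ⟨kappa δ Set.univ + 1 - kappa δ S, by omega⟩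
  obtain ⟨x, hx, y, hy, hxy⟩ : ∃ x ∈ S, ∃ y ∈ S, ¬ InsepUpTo δ m x y := by
    by_contra! hall
    have hlt := lt_ncard_range_insepUpTo ⟨p, q, hall p hp q hq, hpq⟩
    have hcount := ncard_image_add_ncard_range_le
      (fun p => {q | Insep δ p q}) (fun p => {q | InsepUpTo δ m p q})
      (fun p q h => setOf_insepUpTo_eq_iff.2 fun u _ => setOf_insep_eq_iff.1 h u)
      ⟨p, hp⟩ (fun p hp q hq => setOf_insepUpTo_eq_iff.2 (hall p hp q hq))
    rw [← Set.image_univ (f := fun p => {q | Insep δ p q}), ← kappa_eq_ncard_image,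
      ← kappa_eq_ncard_image] at hcount
    omega
  simp only [InsepUpTo, not_forall] at hxy
  obtain ⟨u, hu, hxy⟩ := hxy
  refine ⟨u, by omega, ?_⟩
  rcases hx' : stepWord δ x u with _ | x' <;> rcases hy' : stepWord δ y u with _ | y' <;>
    simp [hx', hy'] at hxy
  · exact ⟨y, hy, x, hx, by simp [hy'], hx'⟩
  · exact ⟨x, hx, y, hy, by simp [hx'], hy'⟩

/-- A word undefined at some state of `S` lowers `κ`. -/
lemma kappa_img_lt [Finite Q] {S : Set Q} {u : List A} {q : Q} (hq : q ∈ S)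
    (hqu : stepWord δ q u = none) : kappa δ (img δ S u) < kappa δ S := by
  have : Nonempty Q := ⟨q⟩
  have hsource : ∀ p ∈ img δ S u, ∃ r ∈ S, stepWord δ r u = some p := fun p hp => hp
  choose! src hsrcS hsrc using hsource
  have hcls : ∀ C ∈ (fun p => {q | Insep δ p q}) '' img δ S u,
      ∃ p ∈ img δ S u, {q | Insep δ p q} = C := fun C hC => hC
  choose! rep hrep hrepC using hcls
  have hsub : (fun C => {r | Insep δ (src (rep C)) r}) ''
      ((fun p => {q | Insep δ p q}) '' img δ S u) ⊂ (fun p => {q | Insep δ p q}) '' S := by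
    refine Set.ssubset_iff_of_subset ?_ |>.2 ⟨_, ⟨q, hq, rfl⟩, ?_⟩
    · rintro _ ⟨C, hC, rfl⟩
      exact ⟨_, hsrcS _ (hrep C hC), rfl⟩
    · rintro ⟨C, hC, h⟩
      have := setOf_insep_eq_iff.1 h u
      simp [hsrc _ (hrep C hC), hqu] at this
  have hinj : Set.InjOn (fun C => {r | Insep δ (src (rep C)) r})
      ((fun p => {q | Insep δ p q}) '' img δ S u) := by
    intro C hC D hD h
    rw [← hrepC C hC, ← hrepC D hD, setOf_insep_eq_iff]
    exact (setOf_insep_eq_iff.1 h).of_stepWord (hsrc _ (hrep C hC)) (hsrc _ (hrep D hD))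
  rw [kappa_eq_ncard_image, kappa_eq_ncard_image, ← hinj.ncard_image]
  exact Set.ncard_lt_ncard hsub (Set.toFinite _)

end Helpers

/-- For non-empty `S` there is a word `w` with
`2|w| ≤ (κ(S) − 1)(2κ(Q) − κ(S))` such that `δ(S,w)` is non-empty and contained in
a single inseparability class. -/
theorem stmt1 {Q A : Type*} [Fintype Q] (δ : Q → A → Option Q) (S : Set Q)
    (hS : S.Nonempty) :
    ∃ w : List A, 2 * w.length ≤ (kappa δ S - 1) * (2 * kappa δ Set.univ - kappa δ S) ∧
      (img δ S w).Nonempty ∧ ∀ p ∈ img δ S w, ∀ q ∈ img δ S w, Insep δ p q := by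
  induction hk : kappa δ S using Nat.strong_induction_on generalizing S with
  | _ k ih =>
    by_cases hsep : ∃ p ∈ S, ∃ q ∈ S, ¬ Insep δ p q
    · obtain ⟨u, hu, p, hp, q, hq, hpu, hqu⟩ := exists_short_separating_word hsep
      obtain ⟨p', hp'⟩ := Option.isSome_iff_exists.1 hpu
      have hlt := kappa_img_lt hq hqu
      have hle := kappa_mono (δ := δ) (Set.subset_univ S)
      have hne : (img δ S u).Nonempty := ⟨p', p, hp, hp'⟩
      have hpos : 0 < kappa δ (img δ S u) := by
        rw [kappa_eq_ncard_image]
        exact (Set.ncard_pos (Set.toFinite _)).2 (hne.image _)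
      obtain ⟨v, hv, hvne, hvsep⟩ := ih _ (hk ▸ hlt) (img δ S u) hne rfl
      refine ⟨u ++ v, ?_, by rwa [img_append], by rwa [img_append]⟩
      rw [List.length_append]
      rw [hk] at hu hlt hle
      generalize kappa δ (img δ S u) = j at *
      generalize kappa δ Set.univ = n at *
      obtain ⟨j, rfl⟩ : ∃ i, j = i + 1 := ⟨j - 1, by omega⟩
      obtain ⟨d, rfl⟩ : ∃ d, k = j + 2 + d := ⟨k - (j + 2), by omega⟩
      obtain ⟨e, rfl⟩ : ∃ e, n = j + 2 + d + e := ⟨n - (j + 2 + d), by omega⟩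
      rw [show j + 1 - 1 = j by omega,
        show 2 * (j + 2 + d + e) - (j + 1) = j + 3 + 2 * d + 2 * e by omega] at hv
      rw [show j + 2 + d - 1 = j + 1 + d by omega,
        show 2 * (j + 2 + d + e) - (j + 2 + d) = j + 2 + d + 2 * e by omega]
      have hu' : u.length ≤ e + 1 := by omega
      nlinarith [Nat.zero_le (d * e), Nat.zero_le (j * d), Nat.zero_le (d * d)]
    · push Not at hsep
      obtain ⟨s, hs⟩ := hS
      refine ⟨[], by simp, ⟨s, s, hs, rfl⟩, ?_⟩
      simpa [img, stepWord] using hsep
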